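/- arXiv:2102.01328 — 2 statements merged into one kernel-verified Lean document; each statement's English description precedes it below -/
import Mathlib

section
/- (Time-varying peak-power, s-domain condition.) Let F* ∈ Ω₂ and let G* be the pushforward of F* under (x₁, x₂) ↦ (1/(1+x₁²), 1/(1+x₂²)), a probability measure on I = [1/(1+A₁²), 1] × [1/(1+A₂²), 1]. If there exist λ₁ ≥ 0 and λ₂ ≥ 0 such that for all (s₁, s₂) ∈ I: λ₁·(p₁·(1/s₁ − 1) + p₂·(1/s₂ − 1) − P) − λ₂·(p₁·ℰ(√(1/s₁ − 1)) + p₂·ℰ(√(1/s₂ − 1)) − E_req) + I(F*) − ∫₀^∞ (p₁·s₁·e^{−s₁·y} + p₂·s₂·e^{−s₂·y})·log((p₁·s₁·e^{−s₁·y} + p₂·s₂·e^{−s₂·y})/f(y; F*)) dy ≥ 0, with equality for every (s₁, s₂) in the topological support of G*, then F* is optimal, i.e., I(F*) = sup_{F ∈ Ω₂} I(F). -/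
open MeasureTheory Real Set Filter

/-- Phase-removed Rayleigh-fading channel density `p(y|x)`. -/
noncomputable def pcond (x y : ℝ) : ℝ := (1 / (1 + x ^ 2)) * Real.exp (-y / (1 + x ^ 2))

/-- Modified Bessel function of the first kind, order zero. -/
noncomputable def besselI0 (t : ℝ) : ℝ := ∑' n : ℕ, (t ^ 2 / 4) ^ n / ((Nat.factorial n : ℝ)) ^ 2

/-- Harvested-energy function `ℰ(x) = I₀(√2 B h₂ x)`. -/
noncomputable def EH (B h2 x : ℝ) : ℝ := besselI0 (Real.sqrt 2 * B * h2 * x)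

/-- Output density `p(y; F)`. -/
noncomputable def pout (F : Measure ℝ) (y : ℝ) : ℝ := ∫ x, pcond x y ∂F

/-- Mutual-information density `i(x; F)`. -/
noncomputable def idens (F : Measure ℝ) (x : ℝ) : ℝ :=
  ∫ y in Set.Ioi (0 : ℝ), pcond x y * Real.log (pcond x y / pout F y)

/-- Mutual information `I(F)`. -/
noncomputable def MI (F : Measure ℝ) : ℝ := ∫ x, idens F x ∂F

/-- Borel probability measure concentrated on `[0, A]`. -/
def IsDistOn (A : ℝ) (F : Measure ℝ) : Prop :=
  IsProbabilityMeasure F ∧ F (Set.Icc 0 A)ᶜ = 0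

/-- The feasible set `Ω`: probability measures on `[0,A]` meeting the AP and EH constraints. -/
def Feas (A P B h2 Ereq : ℝ) (F : Measure ℝ) : Prop :=
  IsDistOn A F ∧ (∫ x, x ^ 2 ∂F) ≤ P ∧ Ereq ≤ ∫ x, EH B h2 x ∂F

/-- Information-energy capacity `C = sup_{F ∈ Ω} I(F)`. -/
noncomputable def Cap (A P B h2 Ereq : ℝ) : ℝ :=
  sSup (MI '' {F | Feas A P B h2 Ereq F})

/-- Topological support of a measure: points all of whose open neighborhoods have
positive measure (the smallest closed set of full measure). -/
def msupp {X : Type*} [TopologicalSpace X] [MeasurableSpace X] (μ : Measure X) : Set X :=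
  {x | ∀ U : Set X, IsOpen U → x ∈ U → 0 < μ U}

/-- Extended (Shannon-strategy) channel density `f(y|x₁,x₂) = p₁ p(y|x₁) + p₂ p(y|x₂)`. -/
noncomputable def fcond (p1 p2 : ℝ) (x : ℝ × ℝ) (y : ℝ) : ℝ :=
  p1 * pcond x.1 y + p2 * pcond x.2 y

/-- Output density `f(y; F)` of the extended channel. -/
noncomputable def fout (p1 p2 : ℝ) (F : Measure (ℝ × ℝ)) (y : ℝ) : ℝ :=
  ∫ x, fcond p1 p2 x y ∂F

/-- Mutual-information density `i(x₁, x₂; F)` of the extended channel. -/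
noncomputable def idens2 (p1 p2 : ℝ) (F : Measure (ℝ × ℝ)) (x : ℝ × ℝ) : ℝ :=
  ∫ y in Set.Ioi (0 : ℝ), fcond p1 p2 x y * Real.log (fcond p1 p2 x y / fout p1 p2 F y)

/-- Mutual information `I(F)` of the extended channel. -/
noncomputable def MI2 (p1 p2 : ℝ) (F : Measure (ℝ × ℝ)) : ℝ := ∫ x, idens2 p1 p2 F x ∂F

/-- Borel probability measure concentrated on `[0, A₁] × [0, A₂]`. -/
def IsDistOn2 (A1 A2 : ℝ) (F : Measure (ℝ × ℝ)) : Prop :=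
  IsProbabilityMeasure F ∧ F (Set.Icc 0 A1 ×ˢ Set.Icc 0 A2)ᶜ = 0

/-- The feasible set `Ω₂` for the time-varying peak-power problem. -/
def Feas2 (A1 A2 p1 p2 P B h2 Ereq : ℝ) (F : Measure (ℝ × ℝ)) : Prop :=
  IsDistOn2 A1 A2 F ∧ (∫ x : ℝ × ℝ, (p1 * x.1 ^ 2 + p2 * x.2 ^ 2) ∂F) ≤ P ∧
    Ereq ≤ ∫ x : ℝ × ℝ, (p1 * EH B h2 x.1 + p2 * EH B h2 x.2) ∂F

/-- Capacity `sup_{F ∈ Ω₂} I(F)` for the time-varying peak-power problem. -/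
noncomputable def Cap2 (A1 A2 p1 p2 P B h2 Ereq : ℝ) : ℝ :=
  sSup (MI2 p1 p2 '' {F | Feas2 A1 A2 p1 p2 P B h2 Ereq F})

lemma continuous_besselI0 : Continuous besselI0 := by
  refine continuous_iff_continuousAt.2 fun t => ?_
  have hc : ContinuousOn besselI0 (Metric.ball 0 (|t| + 1)) := by
    refine continuousOn_tsum (fun n => by fun_prop)
      (Real.summable_pow_div_factorial ((|t| + 1) ^ 2 / 4)) fun n x hx => ?_
    rw [mem_ball_zero_iff, Real.norm_eq_abs] at hx
    have hx2 : x ^ 2 ≤ (|t| + 1) ^ 2 := by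
      rw [← sq_abs x]
      gcongr
    have h1 : (1 : ℝ) ≤ (n.factorial : ℝ) := by exact_mod_cast n.factorial_pos
    rw [Real.norm_of_nonneg (by positivity)]
    gcongr
    nlinarith
  exact hc.continuousAt (Metric.isOpen_ball.mem_nhds (by simp))

lemma continuous_EH (B h2 : ℝ) : Continuous (EH B h2) :=
  continuous_besselI0.comp (by fun_prop)

lemma measurable_fcond (p1 p2 : ℝ) :
    Measurable fun z : (ℝ × ℝ) × ℝ => fcond p1 p2 z.1 z.2 := by
  unfold fcond pcond
  fun_prop

lemma measurable_fout (p1 p2 : ℝ) (F : Measure (ℝ × ℝ)) [SFinite F] :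
    Measurable (fout p1 p2 F) :=
  ((measurable_fcond p1 p2).stronglyMeasurable.integral_prod_left').measurable

lemma integrableOn_pcond (x : ℝ) : IntegrableOn (pcond x) (Ioi 0) := by
  have hs : 0 < 1 / (1 + x ^ 2) := by positivity
  refine ((integrableOn_exp_mul_Ioi (neg_lt_zero.2 hs) 0).const_mul (1 / (1 + x ^ 2))).congr
    (ae_of_all _ fun y => ?_)
  simp only [pcond]
  congr 2
  ring

lemma integral_pcond (x : ℝ) : ∫ y in Ioi (0 : ℝ), pcond x y = 1 := by
  have hs : 0 < 1 / (1 + x ^ 2) := by positivity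
  have h : ∀ y, pcond x y = 1 / (1 + x ^ 2) * Real.exp (-(1 / (1 + x ^ 2)) * y) := fun y => by
    simp only [pcond]
    congr 2
    ring
  simp_rw [h]
  rw [integral_const_mul, integral_exp_mul_Ioi (neg_lt_zero.2 hs)]
  simp only [mul_zero, Real.exp_zero]
  field_simp

lemma integral_fcond {p1 p2 : ℝ} (hp : p1 + p2 = 1) (x : ℝ × ℝ) :
    ∫ y in Ioi (0 : ℝ), fcond p1 p2 x y = 1 := by
  simp only [fcond]
  rw [integral_add ((integrableOn_pcond _).const_mul _) ((integrableOn_pcond _).const_mul _),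
    integral_const_mul, integral_const_mul, integral_pcond, integral_pcond]
  linarith

lemma pcond_mem_Icc {a A x y : ℝ} (haA : a ≤ 1 / (1 + A ^ 2))
    (hx : x ∈ Icc 0 A) (hy : 0 < y) :
    pcond x y ∈ Icc (a * Real.exp (-y)) (Real.exp (-(a * y))) := by
  have hxA : x ^ 2 ≤ A ^ 2 := pow_le_pow_left₀ hx.1 hx.2 2
  have hs : a ≤ 1 / (1 + x ^ 2) := haA.trans (by gcongr)
  have hs1 : 1 / (1 + x ^ 2) ≤ 1 := (div_le_one (by positivity)).2 (by nlinarith [sq_nonneg x])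
  have hdiv : -y / (1 + x ^ 2) = -(1 / (1 + x ^ 2) * y) := by ring
  rw [pcond, hdiv]
  constructor
  · gcongr
    nlinarith
  · refine (mul_le_of_le_one_left (Real.exp_pos _).le hs1).trans ?_
    gcongr

lemma fcond_mem_Icc {a A1 A2 p1 p2 y : ℝ} {x : ℝ × ℝ}
    (ha1 : a ≤ 1 / (1 + A1 ^ 2)) (ha2 : a ≤ 1 / (1 + A2 ^ 2))
    (hp1 : 0 < p1) (hp2 : 0 < p2) (hp : p1 + p2 = 1)
    (hx : x ∈ Icc 0 A1 ×ˢ Icc 0 A2) (hy : 0 < y) :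
    fcond p1 p2 x y ∈ Icc (a * Real.exp (-y)) (Real.exp (-(a * y))) := by
  simpa [fcond] using convex_Icc (a * Real.exp (-y)) (Real.exp (-(a * y)))
    (pcond_mem_Icc ha1 hx.1 hy) (pcond_mem_Icc ha2 hx.2 hy) hp1.le hp2.le hp

lemma IsDistOn2.ae_mem {A1 A2 : ℝ} {F : Measure (ℝ × ℝ)} (hF : IsDistOn2 A1 A2 F) :
    ∀ᵐ x ∂F, x ∈ Icc 0 A1 ×ˢ Icc 0 A2 :=
  mem_ae_iff.2 hF.2

lemma IsDistOn2.integrable_of_continuous {A1 A2 : ℝ} {F : Measure (ℝ × ℝ)}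
    (hF : IsDistOn2 A1 A2 F) {g : ℝ × ℝ → ℝ} (hg : Continuous g) : Integrable g F := by
  have := hF.1
  obtain ⟨C, hC⟩ := (isCompact_Icc.prod isCompact_Icc :
    IsCompact (Icc 0 A1 ×ˢ Icc 0 A2)).exists_bound_of_continuousOn hg.continuousOn
  exact Integrable.of_bound hg.aestronglyMeasurable C (hF.ae_mem.mono hC)

lemma fout_mem_Icc {a A1 A2 p1 p2 y : ℝ} {F : Measure (ℝ × ℝ)}
    (ha1 : a ≤ 1 / (1 + A1 ^ 2)) (ha2 : a ≤ 1 / (1 + A2 ^ 2))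
    (hp1 : 0 < p1) (hp2 : 0 < p2) (hp : p1 + p2 = 1)
    (hF : IsDistOn2 A1 A2 F) (hy : 0 < y) :
    fout p1 p2 F y ∈ Icc (a * Real.exp (-y)) (Real.exp (-(a * y))) := by
  have := hF.1
  have hmem := hF.ae_mem.mono fun x hx => fcond_mem_Icc ha1 ha2 hp1 hp2 hp hx hy
  refine (convex_Icc _ _).integral_mem isClosed_Icc hmem
    (hF.integrable_of_continuous ?_)
  unfold fcond pcond
  have (x : ℝ) : 1 + x ^ 2 ≠ 0 := by positivity
  fun_prop (disch := simp [this])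

lemma abs_log_div_le {a y u v : ℝ} (ha : 0 < a) (hy : 0 < y)
    (hu : u ∈ Icc (a * Real.exp (-y)) (Real.exp (-(a * y))))
    (hv : v ∈ Icc (a * Real.exp (-y)) (Real.exp (-(a * y)))) :
    |Real.log (u / v)| ≤ y + -Real.log a := by
  have hlow : 0 < a * Real.exp (-y) := by positivity
  have hlog : ∀ w ∈ Icc (a * Real.exp (-y)) (Real.exp (-(a * y))),
      Real.log a - y ≤ Real.log w ∧ Real.log w ≤ 0 := fun w hw => by
    have h1 := Real.log_le_log hlow hw.1
    have h2 := Real.log_le_log (hlow.trans_le hw.1) hw.2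
    rw [Real.log_mul ha.ne' (Real.exp_pos _).ne', Real.log_exp] at h1
    rw [Real.log_exp] at h2
    have := mul_pos ha hy
    constructor <;> linarith
  rw [Real.log_div (hlow.trans_le hu.1).ne' (hlow.trans_le hv.1).ne', abs_le]
  have := hlog u hu
  have := hlog v hv
  constructor <;> linarith

lemma integrableOn_exp_mul_add {a : ℝ} (ha : 0 < a) (C : ℝ) :
    IntegrableOn (fun y => Real.exp (-(a * y)) * (y + C)) (Ioi 0) := by
  have h1 := integrableOn_rpow_mul_exp_neg_mul_rpow (p := 1) (s := 1) (by norm_num) one_pos ha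
  have h2 := (integrableOn_exp_mul_Ioi (neg_lt_zero.2 ha) 0).const_mul C
  refine (h1.add h2).congr (ae_of_all _ fun y => ?_)
  simp only [Pi.add_apply, Real.rpow_one, neg_mul]
  ring

lemma IsDistOn2.ae_prod_mem {A1 A2 : ℝ} {F : Measure (ℝ × ℝ)} (hF : IsDistOn2 A1 A2 F) :
    ∀ᵐ z ∂F.prod (volume.restrict (Ioi (0 : ℝ))), z.1 ∈ Icc 0 A1 ×ˢ Icc 0 A2 ∧ 0 < z.2 := by
  have := hF.1
  exact (Measure.quasiMeasurePreserving_fst.ae hF.ae_mem).and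
    (Measure.quasiMeasurePreserving_snd.ae (ae_restrict_mem measurableSet_Ioi))

section MutualInformation

variable {A1 A2 p1 p2 : ℝ} {F G : Measure (ℝ × ℝ)}

lemma IsDistOn2.integrable_fcond_mul (hp1 : 0 < p1) (hp2 : 0 < p2) (hp : p1 + p2 = 1)
    (hF : IsDistOn2 A1 A2 F) {a C : ℝ} (ha : 0 < a) (ha1 : a ≤ 1 / (1 + A1 ^ 2))
    (ha2 : a ≤ 1 / (1 + A2 ^ 2)) {h : (ℝ × ℝ) × ℝ → ℝ} (hm : Measurable h)
    (hb : ∀ z : (ℝ × ℝ) × ℝ, z.1 ∈ Icc 0 A1 ×ˢ Icc 0 A2 → 0 < z.2 → |h z| ≤ z.2 + C) :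
    Integrable (fun z => fcond p1 p2 z.1 z.2 * h z) (F.prod (volume.restrict (Ioi (0 : ℝ)))) := by
  have := hF.1
  refine ((integrableOn_exp_mul_add ha C).integrable.comp_snd F).mono'
    ((measurable_fcond p1 p2).mul hm).aestronglyMeasurable (hF.ae_prod_mem.mono fun z hz => ?_)
  have hf := fcond_mem_Icc ha1 ha2 hp1 hp2 hp hz.1 hz.2
  have h0 : 0 ≤ fcond p1 p2 z.1 z.2 := le_trans (by positivity) hf.1
  rw [norm_mul, Real.norm_of_nonneg h0, Real.norm_eq_abs]
  exact mul_le_mul hf.2 (hb z hz.1 hz.2) (abs_nonneg _) (Real.exp_pos _).le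

lemma exists_pos_le_one_div (A1 A2 : ℝ) :
    ∃ a : ℝ, 0 < a ∧ a ≤ 1 / (1 + A1 ^ 2) ∧ a ≤ 1 / (1 + A2 ^ 2) :=
  ⟨min (1 / (1 + A1 ^ 2)) (1 / (1 + A2 ^ 2)), lt_min (by positivity) (by positivity),
    min_le_left _ _, min_le_right _ _⟩

lemma IsDistOn2.integrable_fcond (hp1 : 0 < p1) (hp2 : 0 < p2) (hp : p1 + p2 = 1)
    (hF : IsDistOn2 A1 A2 F) :
    Integrable (fun z : (ℝ × ℝ) × ℝ => fcond p1 p2 z.1 z.2)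
      (F.prod (volume.restrict (Ioi (0 : ℝ)))) := by
  obtain ⟨a, ha, ha1, ha2⟩ := exists_pos_le_one_div A1 A2
  simpa using hF.integrable_fcond_mul hp1 hp2 hp ha ha1 ha2 (C := 1) (h := fun _ => 1)
    measurable_const fun z _ hz => by simpa using hz.le

lemma IsDistOn2.integrableOn_fout (hp1 : 0 < p1) (hp2 : 0 < p2) (hp : p1 + p2 = 1)
    (hF : IsDistOn2 A1 A2 F) : IntegrableOn (fout p1 p2 F) (Ioi 0) :=
  have := hF.1
  (hF.integrable_fcond hp1 hp2 hp).integral_prod_right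

lemma IsDistOn2.integral_fout (hp1 : 0 < p1) (hp2 : 0 < p2) (hp : p1 + p2 = 1)
    (hF : IsDistOn2 A1 A2 F) : ∫ y in Ioi (0 : ℝ), fout p1 p2 F y = 1 := by
  have := hF.1
  simp only [fout]
  rw [← integral_integral_swap (f := fcond p1 p2) (hF.integrable_fcond hp1 hp2 hp)]
  simp [integral_fcond hp]

lemma IsDistOn2.integrable_fcond_mul_log_div_fout (hp1 : 0 < p1) (hp2 : 0 < p2)
    (hp : p1 + p2 = 1) (hF : IsDistOn2 A1 A2 F) (hG : IsDistOn2 A1 A2 G) :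
    Integrable (fun z : (ℝ × ℝ) × ℝ =>
        fcond p1 p2 z.1 z.2 * Real.log (fcond p1 p2 z.1 z.2 / fout p1 p2 G z.2))
      (F.prod (volume.restrict (Ioi (0 : ℝ)))) := by
  have := hG.1
  obtain ⟨a, ha, ha1, ha2⟩ := exists_pos_le_one_div A1 A2
  refine hF.integrable_fcond_mul hp1 hp2 hp ha ha1 ha2
    ((measurable_fcond p1 p2).div ((measurable_fout p1 p2 G).comp measurable_snd)).log
    fun z hz hy => abs_log_div_le ha hy (fcond_mem_Icc ha1 ha2 hp1 hp2 hp hz hy)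
      (fout_mem_Icc ha1 ha2 hp1 hp2 hp hG hy)

lemma IsDistOn2.integrable_idens2 (hp1 : 0 < p1) (hp2 : 0 < p2) (hp : p1 + p2 = 1)
    (hF : IsDistOn2 A1 A2 F) (hG : IsDistOn2 A1 A2 G) : Integrable (idens2 p1 p2 G) F :=
  (hF.integrable_fcond_mul_log_div_fout hp1 hp2 hp hG).integral_prod_left

/-- Gibbs' inequality: replacing the output density of `F` by that of another input
distribution inside the logarithm can only increase the mutual information. -/
lemma IsDistOn2.MI2_le_integral_idens2 (hp1 : 0 < p1) (hp2 : 0 < p2) (hp : p1 + p2 = 1)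
    (hF : IsDistOn2 A1 A2 F) (hG : IsDistOn2 A1 A2 G) :
    MI2 p1 p2 F ≤ ∫ x, idens2 p1 p2 G x ∂F := by
  have := hF.1
  have := hG.1
  obtain ⟨a, ha, ha1, ha2⟩ := exists_pos_le_one_div A1 A2
  have hfout {H : Measure (ℝ × ℝ)} (hH : IsDistOn2 A1 A2 H) {y : ℝ} (hy : 0 < y) :
      fout p1 p2 H y ∈ Icc (a * Real.exp (-y)) (Real.exp (-(a * y))) :=
    fout_mem_Icc ha1 ha2 hp1 hp2 hp hH hy
  have hpos {y u : ℝ} (hu : u ∈ Icc (a * Real.exp (-y)) (Real.exp (-(a * y)))) : 0 < u :=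
    lt_of_lt_of_le (by positivity) hu.1
  have hiF := hF.integrable_fcond_mul_log_div_fout hp1 hp2 hp hF
  have hiG := hF.integrable_fcond_mul_log_div_fout hp1 hp2 hp hG
  have hiGF := hF.integrable_fcond_mul hp1 hp2 hp ha ha1 ha2
    (h := fun z => Real.log (fout p1 p2 G z.2 / fout p1 p2 F z.2))
    (((measurable_fout p1 p2 G).div (measurable_fout p1 p2 F)).log.comp measurable_snd)
    fun z _ hy => abs_log_div_le ha hy (hfout hG hy) (hfout hF hy)
  have hdiff : MI2 p1 p2 F - ∫ x, idens2 p1 p2 G x ∂F =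
      ∫ y in Ioi (0 : ℝ), fout p1 p2 F y * Real.log (fout p1 p2 G y / fout p1 p2 F y) := by
    simp only [MI2, idens2]
    rw [← integral_prod _ hiF, ← integral_prod _ hiG, ← integral_sub hiF hiG]
    trans ∫ z : (ℝ × ℝ) × ℝ, fcond p1 p2 z.1 z.2 *
        Real.log (fout p1 p2 G z.2 / fout p1 p2 F z.2) ∂F.prod (volume.restrict (Ioi (0 : ℝ)))
    · refine integral_congr_ae (hF.ae_prod_mem.mono fun z hz => ?_)
      have h0 := (hpos (fcond_mem_Icc ha1 ha2 hp1 hp2 hp hz.1 hz.2)).ne'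
      have h1 := (hpos (hfout hF hz.2)).ne'
      have h2 := (hpos (hfout hG hz.2)).ne'
      simp only
      rw [Real.log_div h0 h1, Real.log_div h0 h2, Real.log_div h2 h1]
      ring
    · rw [integral_prod_symm _ hiGF]
      simp only [integral_mul_const]
      rfl
  have hnonpos : ∫ y in Ioi (0 : ℝ),
      fout p1 p2 F y * Real.log (fout p1 p2 G y / fout p1 p2 F y) ≤ 0 := by
    have hint := hiGF.integral_prod_right
    simp only [integral_mul_const] at hint
    refine (setIntegral_mono_on hint
      ((hG.integrableOn_fout hp1 hp2 hp).sub (hF.integrableOn_fout hp1 hp2 hp))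
      measurableSet_Ioi fun y hy => ?_).trans_eq ?_
    · have h1 := hpos (hfout hF hy)
      have h2 := hpos (hfout hG hy)
      calc fout p1 p2 F y * Real.log (fout p1 p2 G y / fout p1 p2 F y)
          ≤ fout p1 p2 F y * (fout p1 p2 G y / fout p1 p2 F y - 1) := by
            gcongr
            exact Real.log_le_sub_one_of_pos (div_pos h2 h1)
        _ = fout p1 p2 G y - fout p1 p2 F y := by field_simp
    · simp only [Pi.sub_apply]
      rw [integral_sub (hG.integrableOn_fout hp1 hp2 hp) (hF.integrableOn_fout hp1 hp2 hp),
        hG.integral_fout hp1 hp2 hp, hF.integral_fout hp1 hp2 hp, sub_self]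
  linarith

end MutualInformation

/-- (Time-varying peak-power, `s`-domain condition.) Let `F* ∈ Ω₂` and
let `G*` be the pushforward of `F*` under `(x₁,x₂) ↦ (1/(1+x₁²), 1/(1+x₂²))`, a
probability measure on `I = [1/(1+A₁²), 1] × [1/(1+A₂²), 1]`. If there exist
`λ₁, λ₂ ≥ 0` such that for all `(s₁, s₂) ∈ I`,
`λ₁(p₁(1/s₁−1)+p₂(1/s₂−1)−P) − λ₂(p₁ℰ(√(1/s₁−1))+p₂ℰ(√(1/s₂−1))−E_req) + I(F*) −
∫₀^∞ (p₁s₁e^{−s₁y}+p₂s₂e^{−s₂y}) log((p₁s₁e^{−s₁y}+p₂s₂e^{−s₂y})/f(y;F*)) dy ≥ 0`,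
with equality on the topological support of `G*`, then `F*` is optimal:
`I(F*) = sup_{F ∈ Ω₂} I(F)`. -/
theorem stmt7 (A1 A2 p1 p2 P B h2 Ereq : ℝ) (hA1 : 0 < A1) (hA2 : 0 < A2)
    (hp1 : 0 < p1) (hp2 : 0 < p2) (hp : p1 + p2 = 1)
    (hP : 0 < P) (hB : 0 < B) (hh2 : 0 < h2)
    (Fstar : Measure (ℝ × ℝ)) (hFstar : Feas2 A1 A2 p1 p2 P B h2 Ereq Fstar)
    (Gstar : Measure (ℝ × ℝ))
    (hGstar : Gstar =
      Measure.map (fun x : ℝ × ℝ => (1 / (1 + x.1 ^ 2), 1 / (1 + x.2 ^ 2))) Fstar)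
    (l1 l2 : ℝ) (hl1 : 0 ≤ l1) (hl2 : 0 ≤ l2)
    (hineq : ∀ s ∈ Set.Icc (1 / (1 + A1 ^ 2)) (1 : ℝ) ×ˢ Set.Icc (1 / (1 + A2 ^ 2)) (1 : ℝ),
      0 ≤ l1 * (p1 * (1 / s.1 - 1) + p2 * (1 / s.2 - 1) - P)
          - l2 * (p1 * EH B h2 (Real.sqrt (1 / s.1 - 1))
                  + p2 * EH B h2 (Real.sqrt (1 / s.2 - 1)) - Ereq)
          + MI2 p1 p2 Fstar
          - ∫ y in Set.Ioi (0 : ℝ),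
              (p1 * s.1 * Real.exp (-s.1 * y) + p2 * s.2 * Real.exp (-s.2 * y)) *
                Real.log ((p1 * s.1 * Real.exp (-s.1 * y) + p2 * s.2 * Real.exp (-s.2 * y)) /
                  fout p1 p2 Fstar y))
    (heq : ∀ s ∈ msupp Gstar,
      l1 * (p1 * (1 / s.1 - 1) + p2 * (1 / s.2 - 1) - P)
          - l2 * (p1 * EH B h2 (Real.sqrt (1 / s.1 - 1))
                  + p2 * EH B h2 (Real.sqrt (1 / s.2 - 1)) - Ereq)
          + MI2 p1 p2 Fstar
          - (∫ y in Set.Ioi (0 : ℝ),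
              (p1 * s.1 * Real.exp (-s.1 * y) + p2 * s.2 * Real.exp (-s.2 * y)) *
                Real.log ((p1 * s.1 * Real.exp (-s.1 * y) + p2 * s.2 * Real.exp (-s.2 * y)) /
                  fout p1 p2 Fstar y)) = 0) :
    MI2 p1 p2 Fstar = Cap2 A1 A2 p1 p2 P B h2 Ereq := by
  suffices h : MI2 p1 p2 Fstar ∈
      upperBounds (MI2 p1 p2 '' {F | Feas2 A1 A2 p1 p2 P B h2 Ereq F}) from
    Eq.symm (IsGreatest.csSup_eq ⟨⟨Fstar, hFstar, rfl⟩, h⟩)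
  rintro _ ⟨F, ⟨hF, hpow, hen⟩, rfl⟩
  have := hF.1
  have hbound : ∀ x ∈ Icc 0 A1 ×ˢ Icc 0 A2, idens2 p1 p2 Fstar x ≤
      l1 * (p1 * x.1 ^ 2 + p2 * x.2 ^ 2 - P)
        - l2 * (p1 * EH B h2 x.1 + p2 * EH B h2 x.2 - Ereq) + MI2 p1 p2 Fstar := by
    rintro ⟨x1, x2⟩ ⟨hx1, hx2⟩
    have hmem {A x : ℝ} (hx : x ∈ Icc 0 A) : 1 / (1 + x ^ 2) ∈ Icc (1 / (1 + A ^ 2)) (1 : ℝ) := by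
      have := pow_le_pow_left₀ hx.1 hx.2 2
      exact ⟨by gcongr, (div_le_one (by positivity)).2 (by nlinarith [sq_nonneg x])⟩
    have hsq (x : ℝ) : 1 / (1 / (1 + x ^ 2)) - 1 = x ^ 2 := by
      rw [one_div_one_div, add_sub_cancel_left]
    have h := hineq (1 / (1 + x1 ^ 2), 1 / (1 + x2 ^ 2)) ⟨hmem hx1, hmem hx2⟩
    simp only [hsq, Real.sqrt_sq hx1.1, Real.sqrt_sq hx2.1] at h
    have hf (y : ℝ) : p1 * (1 / (1 + x1 ^ 2)) * Real.exp (-(1 / (1 + x1 ^ 2)) * y) +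
        p2 * (1 / (1 + x2 ^ 2)) * Real.exp (-(1 / (1 + x2 ^ 2)) * y) =
        fcond p1 p2 (x1, x2) y := by
      have he (x : ℝ) : -(1 / (1 + x ^ 2)) * y = -y / (1 + x ^ 2) := by ring
      simp only [fcond, pcond, he, mul_assoc]
    simp only [hf] at h
    simp only [idens2]
    linarith
  have hi1 : Integrable (fun x : ℝ × ℝ => p1 * x.1 ^ 2 + p2 * x.2 ^ 2) F :=
    hF.integrable_of_continuous (by fun_prop)
  have hi2 : Integrable (fun x : ℝ × ℝ => p1 * EH B h2 x.1 + p2 * EH B h2 x.2) F := by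
    have := continuous_EH B h2
    exact hF.integrable_of_continuous (by fun_prop)
  have hiP : Integrable (fun x : ℝ × ℝ => l1 * (p1 * x.1 ^ 2 + p2 * x.2 ^ 2 - P)) F :=
    (hi1.sub (integrable_const P)).const_mul l1
  have hiE : Integrable
      (fun x : ℝ × ℝ => l2 * (p1 * EH B h2 x.1 + p2 * EH B h2 x.2 - Ereq)) F :=
    (hi2.sub (integrable_const Ereq)).const_mul l2
  have hiPE : Integrable (fun x : ℝ × ℝ => l1 * (p1 * x.1 ^ 2 + p2 * x.2 ^ 2 - P)
      - l2 * (p1 * EH B h2 x.1 + p2 * EH B h2 x.2 - Ereq)) F := hiP.sub hiE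
  calc MI2 p1 p2 F ≤ ∫ x, idens2 p1 p2 Fstar x ∂F :=
        hF.MI2_le_integral_idens2 hp1 hp2 hp hFstar.1
    _ ≤ ∫ x, (l1 * (p1 * x.1 ^ 2 + p2 * x.2 ^ 2 - P)
        - l2 * (p1 * EH B h2 x.1 + p2 * EH B h2 x.2 - Ereq) + MI2 p1 p2 Fstar) ∂F :=
        integral_mono_ae (hF.integrable_idens2 hp1 hp2 hp hFstar.1)
          (hiPE.add (integrable_const _)) (hF.ae_mem.mono hbound)
    _ = l1 * ((∫ x : ℝ × ℝ, (p1 * x.1 ^ 2 + p2 * x.2 ^ 2) ∂F) - P)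
        - l2 * ((∫ x : ℝ × ℝ, (p1 * EH B h2 x.1 + p2 * EH B h2 x.2) ∂F) - Ereq)
        + MI2 p1 p2 Fstar := by
        rw [integral_add hiPE (integrable_const _), integral_sub hiP hiE,
          integral_const_mul, integral_const_mul, integral_sub hi1 (integrable_const _),
          integral_sub hi2 (integrable_const _)]
        simp
    _ ≤ MI2 p1 p2 Fstar := by
        have := mul_nonneg hl1 (sub_nonneg.2 hpow)
        have := mul_nonneg hl2 (sub_nonneg.2 hen)
        linarith
end

section
/- The mutual-information functional F ↦ I(F) is strictly concave on the space of Borel probability measures on [0, A]: for any two distinct Borel probability measures F₀ ≠ F₁ on [0, A] and every t ∈ (0, 1), I((1−t)·F₀ + t·F₁) > (1−t)·I(F₀) + t·I(F₁). -/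
open MeasureTheory Real Set Filter

open ProbabilityTheory

lemma pcond_eq (x y : ℝ) : pcond x y = (1 + x ^ 2)⁻¹ * exp (-y * (1 + x ^ 2)⁻¹) := by
  simp [pcond, div_eq_mul_inv]

lemma pcond_pos (x y : ℝ) : 0 < pcond x y := by
  unfold pcond; positivity

lemma measurable_pcond : Measurable fun p : ℝ × ℝ => pcond p.1 p.2 := by
  unfold pcond; fun_prop

lemma inv_one_add_sq_mem_Icc (x : ℝ) : (1 + x ^ 2)⁻¹ ∈ Icc (0 : ℝ) 1 :=
  ⟨by positivity, inv_le_one_of_one_le₀ (by nlinarith [sq_nonneg x])⟩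

lemma pcond_le_exp {A x y : ℝ} (hx : x ∈ Icc 0 A) (hy : 0 ≤ y) :
    pcond x y ≤ exp (-(1 + A ^ 2)⁻¹ * y) := by
  have hs : (1 + A ^ 2)⁻¹ ≤ (1 + x ^ 2)⁻¹ := by
    have := pow_le_pow_left₀ hx.1 hx.2 2
    gcongr
  rw [pcond_eq]
  calc (1 + x ^ 2)⁻¹ * exp (-y * (1 + x ^ 2)⁻¹) ≤ 1 * exp (-y * (1 + x ^ 2)⁻¹) := by
        gcongr; exact (inv_one_add_sq_mem_Icc x).2
    _ ≤ exp (-(1 + A ^ 2)⁻¹ * y) := by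
        rw [one_mul, exp_le_exp]; nlinarith

lemma exp_le_pcond {A x y : ℝ} (hx : x ∈ Icc 0 A) (hy : 0 ≤ y) :
    (1 + A ^ 2)⁻¹ * exp (-y) ≤ pcond x y := by
  have hs : (1 + A ^ 2)⁻¹ ≤ (1 + x ^ 2)⁻¹ := by
    have := pow_le_pow_left₀ hx.1 hx.2 2
    gcongr
  rw [pcond_eq]
  have := (inv_one_add_sq_mem_Icc x).2
  gcongr
  nlinarith

lemma IsDistOn.ae_mem {A : ℝ} {F : Measure ℝ} (h : IsDistOn A F) : ∀ᵐ x ∂F, x ∈ Icc 0 A :=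
  h.2

lemma IsDistOn.integrable_pcond {A : ℝ} {F : Measure ℝ} (h : IsDistOn A F) {y : ℝ}
    (hy : 0 ≤ y) : Integrable (fun x => pcond x y) F := by
  have := h.1
  refine Integrable.of_mem_Icc 0 (exp (-(1 + A ^ 2)⁻¹ * y))
    (measurable_pcond.comp (measurable_id.prodMk measurable_const)).aemeasurable ?_
  filter_upwards [h.ae_mem] with x hx
  exact ⟨(pcond_pos x y).le, pcond_le_exp hx hy⟩

lemma IsDistOn.pout_mem {A : ℝ} {F : Measure ℝ} (h : IsDistOn A F) {y : ℝ} (hy : 0 ≤ y) :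
    pout F y ∈ Icc ((1 + A ^ 2)⁻¹ * exp (-y)) (exp (-(1 + A ^ 2)⁻¹ * y)) := by
  have := h.1
  constructor
  · calc (1 + A ^ 2)⁻¹ * exp (-y) = ∫ _, (1 + A ^ 2)⁻¹ * exp (-y) ∂F := by simp
      _ ≤ pout F y := integral_mono_ae (integrable_const _) (h.integrable_pcond hy)
        (h.ae_mem.mono fun x hx => exp_le_pcond hx hy)
  · calc pout F y ≤ ∫ _, exp (-(1 + A ^ 2)⁻¹ * y) ∂F :=
        integral_mono_ae (h.integrable_pcond hy) (integrable_const _)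
          (h.ae_mem.mono fun x hx => pcond_le_exp hx hy)
      _ = _ := by simp

lemma IsDistOn.pout_pos {A : ℝ} {F : Measure ℝ} (h : IsDistOn A F) {y : ℝ} (hy : 0 ≤ y) :
    0 < pout F y :=
  lt_of_lt_of_le (by positivity) (h.pout_mem hy).1

lemma measurable_pout (F : Measure ℝ) [SFinite F] : Measurable (pout F) :=
  (measurable_pcond.stronglyMeasurable.integral_prod_left' (μ := F)).measurable

lemma abs_log_le {A u y : ℝ} (hy : 0 ≤ y)
    (hu : u ∈ Icc ((1 + A ^ 2)⁻¹ * exp (-y)) (exp (-(1 + A ^ 2)⁻¹ * y))) :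
    |log u| ≤ log (1 + A ^ 2) + y := by
  have hpos : 0 < (1 + A ^ 2)⁻¹ * exp (-y) := by positivity
  have h1 := log_le_log hpos hu.1
  rw [log_mul (by positivity) (exp_ne_zero _), log_inv, log_exp] at h1
  have h2 := log_le_log (hpos.trans_le hu.1) hu.2
  rw [log_exp] at h2
  have h3 : 0 ≤ log (1 + A ^ 2) := log_nonneg (by nlinarith [sq_nonneg A])
  have h4 : 0 ≤ (1 + A ^ 2)⁻¹ * y := by positivity
  rw [abs_le]
  constructor <;> linarith

lemma integrableOn_exp_mul_const_add {b : ℝ} (hb : 0 < b) (C : ℝ) :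
    IntegrableOn (fun y => exp (-b * y) * (C + y)) (Ioi 0) := by
  have h1 : IntegrableOn (fun y : ℝ => exp (-b * y)) (Ioi 0) := exp_neg_integrableOn_Ioi 0 hb
  have h2 := integrableOn_rpow_mul_exp_neg_mul_rpow (p := 1) (s := 1) (by norm_num) one_pos hb
  refine ((h1.mul_const C).add h2).congr (Eventually.of_forall fun y => ?_)
  simp [add_mul, mul_comm]

lemma IsDistOn.integrable_pcond_mul_log {A : ℝ} {F : Measure ℝ} (h : IsDistOn A F)
    {g : ℝ × ℝ → ℝ} (hg : Measurable g)
    (hgb : ∀ x ∈ Icc 0 A, ∀ y, 0 ≤ y →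
      g (x, y) ∈ Icc ((1 + A ^ 2)⁻¹ * exp (-y)) (exp (-(1 + A ^ 2)⁻¹ * y))) :
    Integrable (fun p : ℝ × ℝ => pcond p.1 p.2 * log (g p))
      (F.prod (volume.restrict (Ioi 0))) := by
  have := h.1
  have hb : 0 < (1 + A ^ 2)⁻¹ := by positivity
  have hdom : Integrable
      (fun p : ℝ × ℝ => exp (-(1 + A ^ 2)⁻¹ * p.2) * (log (1 + A ^ 2) + p.2))
      (F.prod (volume.restrict (Ioi 0))) :=
    Integrable.comp_snd (integrableOn_exp_mul_const_add hb (log (1 + A ^ 2))) F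
  refine hdom.mono' (measurable_pcond.mul (measurable_log.comp hg)).aestronglyMeasurable ?_
  have hx : ∀ᵐ p ∂F.prod (volume.restrict (Ioi (0 : ℝ))), p.1 ∈ Icc 0 A :=
    Measure.quasiMeasurePreserving_fst.ae h.ae_mem
  have hy : ∀ᵐ p ∂F.prod (volume.restrict (Ioi (0 : ℝ))), p.2 ∈ Ioi (0 : ℝ) :=
    Measure.quasiMeasurePreserving_snd.ae (ae_restrict_mem measurableSet_Ioi)
  filter_upwards [hx, hy] with p hpx hpy
  have hpy' : 0 ≤ p.2 := le_of_lt hpy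
  rw [norm_mul, norm_eq_abs, norm_eq_abs, abs_of_pos (pcond_pos _ _)]
  exact mul_le_mul (pcond_le_exp hpx hpy') (abs_log_le hpy' (hgb _ hpx _ hpy'))
    (abs_nonneg _) (exp_nonneg _)

/-- Minus the conditional differential entropy of the output given the input `x`. -/
noncomputable def condNegEntropy (x : ℝ) : ℝ :=
  ∫ y in Ioi (0 : ℝ), pcond x y * log (pcond x y)

lemma IsDistOn.integrable_pcond_mul_log_pcond {A : ℝ} {F : Measure ℝ} (h : IsDistOn A F) :
    Integrable (fun p : ℝ × ℝ => pcond p.1 p.2 * log (pcond p.1 p.2))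
      (F.prod (volume.restrict (Ioi 0))) :=
  h.integrable_pcond_mul_log measurable_pcond
    fun _ hx _ hy => ⟨exp_le_pcond hx hy, pcond_le_exp hx hy⟩

lemma IsDistOn.integrable_pcond_mul_log_pout {A : ℝ} {F : Measure ℝ} (h : IsDistOn A F) :
    Integrable (fun p : ℝ × ℝ => pcond p.1 p.2 * log (pout F p.2))
      (F.prod (volume.restrict (Ioi 0))) :=
  have := h.1
  h.integrable_pcond_mul_log ((measurable_pout F).comp measurable_snd)
    fun _ _ _ hy => h.pout_mem hy

lemma IsDistOn.integrable_condNegEntropy {A : ℝ} {F : Measure ℝ} (h : IsDistOn A F) :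
    Integrable condNegEntropy F :=
  have := h.1
  h.integrable_pcond_mul_log_pcond.integral_prod_left

lemma IsDistOn.integrableOn_pout_mul_log {A : ℝ} {F : Measure ℝ} (h : IsDistOn A F) :
    IntegrableOn (fun y => pout F y * log (pout F y)) (Ioi 0) := by
  have := h.1
  refine h.integrable_pcond_mul_log_pout.integral_prod_right.congr
    (Eventually.of_forall fun y => ?_)
  exact integral_mul_const (log (pout F y)) fun x => pcond x y

lemma IsDistOn.MI_eq {A : ℝ} {F : Measure ℝ} (h : IsDistOn A F) :
    MI F = ∫ x, condNegEntropy x ∂F - ∫ y in Ioi (0 : ℝ), pout F y * log (pout F y) := by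
  have := h.1
  have hswap : ∫ x, (∫ y in Ioi (0 : ℝ), pcond x y * log (pout F y)) ∂F
      = ∫ y in Ioi (0 : ℝ), pout F y * log (pout F y) := by
    rw [integral_integral_swap h.integrable_pcond_mul_log_pout]
    exact integral_congr_ae (Eventually.of_forall fun y =>
      integral_mul_const (log (pout F y)) fun x => pcond x y)
  rw [← hswap]
  refine (integral_congr_ae ?_).trans (integral_sub h.integrable_condNegEntropy
    h.integrable_pcond_mul_log_pout.integral_prod_left)
  filter_upwards [h.integrable_pcond_mul_log_pcond.prod_right_ae,
    h.integrable_pcond_mul_log_pout.prod_right_ae] with x h1 h2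
  simp only [idens, condNegEntropy]
  rw [← integral_sub h1 h2]
  refine setIntegral_congr_fun measurableSet_Ioi fun y hy => ?_
  rw [log_div (pcond_pos x y).ne' (h.pout_pos (le_of_lt hy)).ne', mul_sub]

section Injectivity

variable (F : Measure ℝ) [IsProbabilityMeasure F]

lemma integrableExpSet_inv_one_add_sq :
    integrableExpSet (fun x : ℝ => (1 + x ^ 2)⁻¹) F = univ :=
  eq_univ_of_forall fun _ => integrable_exp_mul_of_mem_Icc
    (by fun_prop) (Eventually.of_forall inv_one_add_sq_mem_Icc)

lemma hasDerivAt_mgf_inv_one_add_sq (z : ℝ) :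
    HasDerivAt (mgf (fun x : ℝ => (1 + x ^ 2)⁻¹) F) (pout F (-z)) z := by
  have h := hasDerivAt_mgf (X := fun x : ℝ => (1 + x ^ 2)⁻¹) (μ := F) (t := z)
    (by simp [integrableExpSet_inv_one_add_sq])
  simpa [pout, pcond_eq] using h

lemma analyticOnNhd_mgf_inv_one_add_sq :
    AnalyticOnNhd ℝ (mgf (fun x : ℝ => (1 + x ^ 2)⁻¹) F) univ :=
  fun _ _ => analyticAt_mgf (by simp [integrableExpSet_inv_one_add_sq])

lemma continuous_pout : Continuous (pout F) := by
  have hd : deriv (mgf (fun x : ℝ => (1 + x ^ 2)⁻¹) F) = fun z => pout F (-z) :=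
    funext fun z => (hasDerivAt_mgf_inv_one_add_sq F z).deriv
  have hc := (analyticOnNhd_mgf_inv_one_add_sq F).deriv.continuousOn
  rw [hd, continuousOn_univ] at hc
  simpa [Function.comp_def] using hc.comp continuous_neg

end Injectivity

/-- The input distribution is determined by the output density. -/
lemma IsDistOn.eq_of_eqOn_pout {A : ℝ} {F G : Measure ℝ} (hF : IsDistOn A F)
    (hG : IsDistOn A G) (h : EqOn (pout F) (pout G) (Ioi 0)) : F = G := by
  have := hF.1
  have := hG.1
  set s : ℝ → ℝ := fun x => (1 + x ^ 2)⁻¹ with hs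
  have hsm : Measurable s := by fun_prop
  have hEq : ∀ z < 0, mgf s F z = mgf s G z := by
    intro z hz
    have hd : ∀ w, HasDerivAt (fun w => mgf s F w - mgf s G w) (pout F (-w) - pout G (-w)) w :=
      fun w => (hasDerivAt_mgf_inv_one_add_sq F w).sub (hasDerivAt_mgf_inv_one_add_sq G w)
    obtain ⟨c, hc, hcz⟩ := exists_hasDerivAt_eq_slope (fun w => mgf s F w - mgf s G w) _ hz
      (fun w _ => (hd w).continuousAt.continuousWithinAt) (fun w _ => hd w)
    rw [h (show 0 < -c by linarith [hc.2]), sub_self, eq_comm, div_eq_zero_iff] at hcz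
    simp only [mgf_zero] at hcz
    rcases hcz with hcz | hcz <;> linarith
  have hmgf : mgf s F = mgf s G := by
    have := (analyticOnNhd_mgf_inv_one_add_sq F).eqOn_of_preconnected_of_eventuallyEq
      (analyticOnNhd_mgf_inv_one_add_sq G) isPreconnected_univ (mem_univ (-1))
      (by filter_upwards [Iio_mem_nhds (show (-1 : ℝ) < 0 by norm_num)] with z hz using hEq z hz)
    exact funext fun z => this (mem_univ z)
  have hmap : F.map s = G.map s := by
    refine Measure.ext_of_complexMGF_eq hsm.aemeasurable hsm.aemeasurable ?_
    funext z
    refine eqOn_complexMGF_of_mgf hmgf ?_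
    simp [hs, integrableExpSet_inv_one_add_sq]
  have hr : Measurable fun u : ℝ => √(u⁻¹ - 1) := by fun_prop
  have hinv : ∀ {H : Measure ℝ}, IsDistOn A H → (H.map s).map (fun u => √(u⁻¹ - 1)) = H := by
    intro H hH
    rw [Measure.map_map hr hsm]
    refine (Measure.map_congr (g := id) ?_).trans Measure.map_id
    filter_upwards [hH.ae_mem] with x hx
    simp [hs, sqrt_sq hx.1]
  rw [← hinv hF, hmap, hinv hG]

section Mixture

variable {A t : ℝ} {F G : Measure ℝ}

lemma IsDistOn.mix (hF : IsDistOn A F) (hG : IsDistOn A G) (ht : t ∈ Icc (0 : ℝ) 1) :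
    IsDistOn A (ENNReal.ofReal (1 - t) • F + ENNReal.ofReal t • G) := by
  have := hF.1
  have := hG.1
  refine ⟨⟨?_⟩, by simp [hF.2, hG.2]⟩
  simp [← ENNReal.ofReal_add (sub_nonneg.2 ht.2) ht.1]

lemma integral_mix (ht : t ∈ Icc (0 : ℝ) 1) {f : ℝ → ℝ} (hf : Integrable f F)
    (hg : Integrable f G) :
    ∫ x, f x ∂(ENNReal.ofReal (1 - t) • F + ENNReal.ofReal t • G)
      = (1 - t) * ∫ x, f x ∂F + t * ∫ x, f x ∂G := by
  rw [integral_add_measure (hf.smul_measure ENNReal.ofReal_ne_top)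
    (hg.smul_measure ENNReal.ofReal_ne_top), integral_smul_measure, integral_smul_measure,
    ENNReal.toReal_ofReal (sub_nonneg.2 ht.2), ENNReal.toReal_ofReal ht.1, smul_eq_mul,
    smul_eq_mul]

end Mixture

/-- Strict concavity of the mutual-information functional: for
distinct Borel probability measures `F₀ ≠ F₁` on `[0, A]` and every `t ∈ (0, 1)`,
`I((1−t)·F₀ + t·F₁) > (1−t)·I(F₀) + t·I(F₁)`. -/
theorem stmt10 (A : ℝ) (hA : 0 < A)
    (F0 F1 : Measure ℝ) (h0 : IsDistOn A F0) (h1 : IsDistOn A F1) (hne : F0 ≠ F1)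
    (t : ℝ) (ht : t ∈ Set.Ioo (0 : ℝ) 1) :
    (1 - t) * MI F0 + t * MI F1 <
      MI (ENNReal.ofReal (1 - t) • F0 + ENNReal.ofReal t • F1) := by
  have := h0.1
  have := h1.1
  have ht' := Ioo_subset_Icc_self ht
  have hm := h0.mix h1 ht'
  rw [h0.MI_eq, h1.MI_eq, hm.MI_eq,
    integral_mix ht' h0.integrable_condNegEntropy h1.integrable_condNegEntropy]
  set M := ENNReal.ofReal (1 - t) • F0 + ENNReal.ofReal t • F1
  have hout : ∀ y, 0 ≤ y → pout M y = (1 - t) * pout F0 y + t * pout F1 y := fun y hy =>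
    integral_mix ht' (h0.integrable_pcond hy) (h1.integrable_pcond hy)
  have hmixint : IntegrableOn (fun y => (1 - t) * (pout F0 y * log (pout F0 y))
      + t * (pout F1 y * log (pout F1 y))) (Ioi 0) :=
    (h0.integrableOn_pout_mul_log.const_mul _).add (h1.integrableOn_pout_mul_log.const_mul _)
  have hle : (fun y => pout M y * log (pout M y)) ≤ᵐ[volume.restrict (Ioi 0)]
      fun y => (1 - t) * (pout F0 y * log (pout F0 y)) + t * (pout F1 y * log (pout F1 y)) := by
    filter_upwards [ae_restrict_mem measurableSet_Ioi] with y hy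
    have hy' : 0 ≤ y := le_of_lt hy
    rw [hout y hy']
    exact convexOn_mul_log.2 (h0.pout_pos hy').le (h1.pout_pos hy').le
      (sub_nonneg.2 ht'.2) ht'.1 (by ring)
  have hlt : ∫ y in Ioi (0 : ℝ), pout M y * log (pout M y) <
      ∫ y in Ioi (0 : ℝ), ((1 - t) * (pout F0 y * log (pout F0 y))
        + t * (pout F1 y * log (pout F1 y))) := by
    refine lt_of_le_of_ne (integral_mono_ae hm.integrableOn_pout_mul_log hmixint hle) fun heq => ?_
    rw [integral_eq_iff_of_ae_le hm.integrableOn_pout_mul_log hmixint hle] at heq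
    refine hne (h0.eq_of_eqOn_pout h1 (Measure.eqOn_open_of_ae_eq (μ := volume) ?_ isOpen_Ioi
      (continuous_pout F0).continuousOn (continuous_pout F1).continuousOn))
    filter_upwards [heq, ae_restrict_mem measurableSet_Ioi] with y hy hy0
    have hy' : 0 ≤ y := le_of_lt hy0
    by_contra hyne
    rw [hout y hy'] at hy
    exact (strictConvexOn_mul_log.2 (h0.pout_pos hy').le (h1.pout_pos hy').le hyne
      (sub_pos.2 ht.2) ht.1 (by ring)).ne hy
  rw [integral_add (h0.integrableOn_pout_mul_log.const_mul _)
    (h1.integrableOn_pout_mul_log.const_mul _), integral_const_mul, integral_const_mul] at hlt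
  linarith
end
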